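/- If a finitely generated group G admits a presentation ⟨X|R⟩ with p-deficiency at least 1 for some prime p, then G is infinite. -/

import Mathlib

/-- `ν_p(r)`: the largest `k` such that `r = w^(p^k)` for some `w` in the free group. -/
noncomputable def nuP {X : Type*} (p : ℕ) (r : FreeGroup X) : ℕ :=
  sSup {k : ℕ | ∃ w : FreeGroup X, w ^ p ^ k = r}

/-- The `p`-deficiency of the presentation `⟨X | R⟩`:
`def_p = |X| - Σ_{r ∈ R} p^{-ν_p(r)}`. -/
noncomputable def pDef {X : Type*} [Fintype X] (p : ℕ) (R : Set (FreeGroup X)) : ℝ :=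
  (Fintype.card X : ℝ) - ∑' r : R, ((p : ℝ) ^ (nuP p (r : FreeGroup X)))⁻¹

/-- Existence of a crossed homomorphism with prescribed values on the generators. -/
theorem exists_crossed {X P A : Type*} [Group P] [AddCommGroup A]
    (π : FreeGroup X →* P) (c : X → P → A) :
    ∃ D : FreeGroup X → P → A, (∀ s x, D (FreeGroup.of s) x = c s x) ∧
      ∀ g h x, D (g * h) x = D h x + D g (π h * x) := by
  let e : X → Equiv.Perm (P × A) := fun s =>
    { toFun := fun y => (π (FreeGroup.of s) * y.1, y.2 + c s y.1)
      invFun := fun y => ((π (FreeGroup.of s))⁻¹ * y.1, y.2 - c s ((π (FreeGroup.of s))⁻¹ * y.1))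
      left_inv := by
        rintro ⟨x, a⟩
        simp
      right_inv := by
        rintro ⟨x, a⟩
        simp }
  let φ : FreeGroup X →* Equiv.Perm (P × A) := FreeGroup.lift e
  have hof : ∀ s x a, φ (FreeGroup.of s) (x, a) = (π (FreeGroup.of s) * x, a + c s x) := by
    intro s x a
    simp [φ, e]
  have key : ∀ g, ∃ d : P → A, ∀ x a, φ g (x, a) = (π g * x, a + d x) := by
    intro g
    induction g using FreeGroup.induction_on with
    | C1 => exact ⟨fun _ => 0, by simp⟩
    | of s => exact ⟨c s, hof s⟩
    | inv_of s _ =>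
      refine ⟨fun x => - c s ((π (FreeGroup.of s))⁻¹ * x), fun x a => ?_⟩
      rw [map_inv, Equiv.Perm.inv_eq_iff_eq, hof]
      simp
    | mul g h hg hh =>
      obtain ⟨d, hd⟩ := hg
      obtain ⟨d', hd'⟩ := hh
      refine ⟨fun x => d' x + d (π h * x), fun x a => ?_⟩
      rw [map_mul, Equiv.Perm.mul_apply, hd', hd, map_mul, mul_assoc, add_assoc]
  choose D hD using key
  refine ⟨D, fun s x => ?_, fun g h x => ?_⟩
  · have := (hD (FreeGroup.of s) x 0).symm.trans (hof s x 0)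
    simpa using this
  · have h1 := hD (g * h) x 0
    rw [map_mul, Equiv.Perm.mul_apply, hD, hD] at h1
    simpa using (congrArg Prod.snd h1).symm

/-- `r` is a `p ^ ν_p(r)`-th power. -/
theorem exists_pow_nuP {X : Type*} (p : ℕ) (r : FreeGroup X) :
    ∃ w : FreeGroup X, w ^ p ^ nuP p r = r := by
  have hne : {k : ℕ | ∃ w : FreeGroup X, w ^ p ^ k = r}.Nonempty := ⟨0, r, by simp⟩
  by_cases hb : BddAbove {k : ℕ | ∃ w : FreeGroup X, w ^ p ^ k = r}
  · exact Nat.sSup_mem hne hb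
  · refine ⟨r, ?_⟩
    have : nuP p r = 0 := by
      unfold nuP
      rw [csSup_of_not_bddAbove hb]
      simp
    rw [this]
    simp


theorem crossed_one {F P A : Type*} [Group F] [Group P] [AddCommGroup A]
  (π : F →* P) (D : F → P → A) (hD : ∀ g h x, D (g * h) x = D h x + D g (π h * x))
    (x : P) : D 1 x = 0 := by
  have := hD 1 1 x
  simpa using this

theorem crossed_pow {F P A : Type*} [Group F] [Group P] [AddCommGroup A]
  (π : F →* P) (D : F → P → A) (hD : ∀ g h x, D (g * h) x = D h x + D g (π h * x))
    (u : F) (hu : π u = 1) (n : ℕ) (x : P) : D (u ^ n) x = n • D u x := by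
  induction n with
  | zero => simpa using crossed_one π D hD x
  | succ n ih => rw [pow_succ, hD, hu, one_mul, ih, succ_nsmul, add_comm]

/-- Bound on the number of conditions imposed by one relator. -/
theorem crossed_finrank {F P A : Type*} [Group F] [Group P] [AddCommGroup A]
  (π : F →* P) (D : F → P → A) (hD : ∀ g h x, D (g * h) x = D h x + D g (π h * x))
    [Finite P] (p : ℕ) [hp : Fact p.Prime] [Module (ZMod p) A]
    (w : F) (ν k : ℕ) (hw : π (w ^ p ^ ν) = 1) (hk : Nat.card P = p ^ k) :
    (Module.finrank (ZMod p) (Submodule.span (ZMod p) (Set.range (D (w ^ p ^ ν)))) : ℝ)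
      ≤ Nat.card P * ((p : ℝ) ^ ν)⁻¹ := by
  have hdvd : orderOf (π w) ∣ p ^ ν := by
    apply orderOf_dvd_of_pow_eq_one
    rw [← map_pow, hw]
  obtain ⟨m, hm, hmo⟩ := (Nat.dvd_prime_pow hp.out).1 hdvd
  have hppos : (0 : ℝ) < p := by exact_mod_cast hp.out.pos
  rcases hm.lt_or_eq with hlt | rfl
  · have h0 : Set.range (D (w ^ p ^ ν)) ⊆ {0} := by
      rintro _ ⟨x, rfl⟩
      have hu : π (w ^ p ^ m) = 1 := by rw [map_pow, ← hmo, pow_orderOf_eq_one]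
      have : w ^ p ^ ν = (w ^ p ^ m) ^ (p ^ (ν - m)) := by
        rw [← pow_mul, ← pow_add, Nat.add_sub_cancel' hm]
      rw [this, crossed_pow π D hD _ hu, ← Nat.cast_smul_eq_nsmul (ZMod p)]
      have : ((p ^ (ν - m) : ℕ) : ZMod p) = 0 := by
        rw [ZMod.natCast_eq_zero_iff]
        exact dvd_pow_self p (by omega)
      rw [this, zero_smul]
      rfl
    have : Submodule.span (ZMod p) (Set.range (D (w ^ p ^ ν))) = ⊥ := by
      rw [Submodule.span_eq_bot]
      exact fun x hx => h0 hx
    rw [this, finrank_bot]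
    simp only [Nat.cast_zero]
    positivity
  · set r := w ^ p ^ m with hr
    have hinv : ∀ x, D r (π w * x) = D r x := by
      intro x
      have h1 := hD r w x
      have h2 := hD w r x
      rw [hw, one_mul] at h2
      have hc : r * w = w * r := by rw [hr, ← pow_succ, ← pow_succ']
      rw [hc, h2, add_comm] at h1
      exact (add_left_cancel h1).symm
    have hinvp : ∀ (n : ℕ) x, D r (π w ^ n * x) = D r x := by
      intro n
      induction n with
      | zero => simp
      | succ n ih => intro x; rw [pow_succ, mul_assoc, ih, hinv]
    let H := Subgroup.zpowers (π w)
    let f : P ⧸ H → A := Quotient.lift (fun y => D r y⁻¹) (by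
      intro a b hab
      have hab' : a⁻¹ * b ∈ H := QuotientGroup.leftRel_apply.1 hab
      obtain ⟨n, hn⟩ := (mem_powers_iff_mem_zpowers (x := π w)).2 hab'
      have hb : a⁻¹ = π w ^ n * b⁻¹ := by
        have : π w ^ n = a⁻¹ * b := hn
        rw [this]; group
      change D r a⁻¹ = D r b⁻¹
      rw [hb, hinvp])
    have hrange : Set.range (D r) = Set.range f := by
      ext a
      constructor
      · rintro ⟨x, rfl⟩
        refine ⟨QuotientGroup.mk x⁻¹, ?_⟩
        change D r x⁻¹⁻¹ = _
        rw [inv_inv]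
      · rintro ⟨y, rfl⟩
        induction y using QuotientGroup.induction_on with
        | H y => exact ⟨y⁻¹, rfl⟩
    have := Fintype.ofFinite (P ⧸ H)
    have h1 : Module.finrank (ZMod p) (Submodule.span (ZMod p) (Set.range f)) ≤ Fintype.card (P ⧸ H) :=
      finrank_range_le_card f
    have h2 := H.card_eq_card_quotient_mul_card_subgroup
    rw [Nat.card_zpowers, hmo, Nat.card_eq_fintype_card (α := P ⧸ H)] at h2
    rw [hrange, h2]
    push_cast
    rw [mul_assoc, mul_inv_cancel₀ (by positivity), mul_one]
    exact_mod_cast h1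

/-- If the crossed homomorphism factors through `P`, its values span a small space. -/
theorem crossed_small {F P A : Type*} [Group F] [Group P] [AddCommGroup A]
  (π : F →* P) (D : F → P → A) (hD : ∀ g h x, D (g * h) x = D h x + D g (π h * x))
    [Finite P] (K : Type*) [DivisionRing K] [Module K A]
    (hπ : Function.Surjective π) (h0 : ∀ g, π g = 1 → ∀ x, D g x = 0) :
    Module.finrank K (Submodule.span K {a | ∃ g x, a = D g x}) < Nat.card P := by
  classical
  have := Fintype.ofFinite P
  choose l hl using hπ
  let f : P → A := fun y => D (l y) 1
  have hf : ∀ g, D g 1 = f (π g) := by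
    intro g
    have h1 := hD (g * (l (π g))⁻¹) (l (π g)) 1
    rw [inv_mul_cancel_right, h0 (g * (l (π g))⁻¹) (by simp [hl]), add_zero] at h1
    exact h1
  have hf1 : f 1 = 0 := h0 _ (hl 1) 1
  have hDf : ∀ g y, D g y = f (π g * y) - f y := by
    intro g y
    have h1 := hD g (l y) 1
    rw [hf, hf, map_mul, hl, mul_one] at h1
    rw [h1]; simp
  let f' : {y : P // y ≠ 1} → A := fun y => f y
  have hmem : ∀ y, f y ∈ Submodule.span K (Set.range f') := by
    intro y
    by_cases hy : y = 1
    · rw [hy, hf1]; exact Submodule.zero_mem _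
    · exact Submodule.subset_span ⟨⟨y, hy⟩, rfl⟩
  have hle : Submodule.span K {a | ∃ g x, a = D g x} ≤ Submodule.span K (Set.range f') := by
    rw [Submodule.span_le]
    rintro _ ⟨g, x, rfl⟩
    rw [hDf]
    exact Submodule.sub_mem _ (hmem _) (hmem _)
  have hfin : FiniteDimensional K (Submodule.span K (Set.range f')) :=
    FiniteDimensional.span_of_finite K (Set.finite_range f')
  have h1 := Submodule.finrank_mono hle
  have h2 : Module.finrank K (Submodule.span K (Set.range f')) ≤ Fintype.card {y : P // y ≠ 1} :=
    finrank_range_le_card f'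
  have h3 : Fintype.card {y : P // y ≠ 1} < Fintype.card P :=
    Fintype.card_subtype_lt (x := 1) (by simp)
  rw [Nat.card_eq_fintype_card]
  omega

/-- The span of a family of subspaces has dimension bounded by the (real) sum. -/
theorem finrank_iSup_le_tsum {K W ι : Type*} [Field K] [AddCommGroup W] [Module K W]
    [FiniteDimensional K W] (U : ι → Submodule K W) (a : ι → ℝ) (ha : Summable a)
    (ha0 : ∀ i, 0 ≤ a i) (h : ∀ i, (Module.finrank K (U i) : ℝ) ≤ a i) :
    (Module.finrank K (⨆ i, U i : Submodule K W) : ℝ) ≤ ∑' i, a i := by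
  classical
  have hc : IsCompactElement (⨆ i, U i) :=
    CompleteLattice.isSupFiniteCompact_iff_all_elements_compact (Submodule K W) |>.1
      (CompleteLattice.WellFoundedGT.isSupFiniteCompact (Submodule K W)) _
  obtain ⟨t, ht⟩ := CompleteLattice.IsCompactElement.exists_finset_of_le_iSup _ hc U le_rfl
  have hb : ∀ t : Finset ι, (Module.finrank K (⨆ i ∈ t, U i : Submodule K W) : ℝ)
      ≤ ∑ i ∈ t, a i := by
    intro t
    induction t using Finset.induction_on with
    | empty => simp
    | insert i t hi ih =>
      rw [Finset.iSup_insert, Finset.sum_insert hi]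
      have h1 : (Module.finrank K (U i ⊔ ⨆ j ∈ t, U j : Submodule K W) : ℝ) ≤
          Module.finrank K (U i) + Module.finrank K (⨆ j ∈ t, U j : Submodule K W) := by
        exact_mod_cast Submodule.finrank_add_le_finrank_add_finrank _ _
      linarith [h i]
  calc (Module.finrank K (⨆ i, U i : Submodule K W) : ℝ)
      ≤ Module.finrank K (⨆ i ∈ t, U i : Submodule K W) := by
        exact_mod_cast Submodule.finrank_mono ht
    _ ≤ ∑ i ∈ t, a i := hb t
    _ ≤ ∑' i, a i := ha.sum_le_tsum t (fun i _ => ha0 i)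

/-- A normal subgroup of maximal `p`-power index among those containing `R`. -/
theorem exists_max_normal {F : Type*} [Group F] (p : ℕ) (R : Set F)
    (hfin : Finite (F ⧸ Subgroup.normalClosure R)) :
    ∃ N : Subgroup F, N.Normal ∧ R ⊆ N ∧ (∃ k, N.index = p ^ k) ∧
      ∀ M : Subgroup F, M.Normal → R ⊆ M → (∃ k, M.index = p ^ k) → M.index ≤ N.index := by
  let S : Set ℕ := {n | ∃ N : Subgroup F, N.Normal ∧ R ⊆ N ∧ (∃ k, N.index = p ^ k) ∧ N.index = n}
  have hS : S.Nonempty := ⟨1, ⊤, inferInstance, by simp, ⟨0, by simp⟩, by simp⟩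
  have hb : BddAbove S := by
    refine ⟨(Subgroup.normalClosure R).index, ?_⟩
    rintro _ ⟨N, hN, hR, -, rfl⟩
    have : (Subgroup.normalClosure R).FiniteIndex := Subgroup.finiteIndex_of_finite_quotient
    exact Nat.le_of_dvd (Nat.pos_of_ne_zero Subgroup.FiniteIndex.index_ne_zero)
      (Subgroup.index_dvd_of_le (Subgroup.normalClosure_le_normal hR))
  obtain ⟨N, hN, hR, hk, hn⟩ := Nat.sSup_mem hS hb
  refine ⟨N, hN, hR, hk, fun M hM hRM hkM => ?_⟩
  rw [hn]
  exact le_csSup hb ⟨M, hM, hRM, hkM, rfl⟩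

/-- If a crossed homomorphism into an elementary abelian `p`-group kills the relators, then by
maximality of `N` it kills `N`. -/
theorem crossed_kill {F : Type*} [Group F] (p : ℕ) [hp : Fact p.Prime] (R : Set F)
    (hfin : Finite (F ⧸ Subgroup.normalClosure R)) (N : Subgroup F) [hN : N.Normal]
    (hR : R ⊆ N) (hk : ∃ k, N.index = p ^ k)
    (hmax : ∀ M : Subgroup F, M.Normal → R ⊆ M → (∃ k, M.index = p ^ k) → M.index ≤ N.index)
    {A : Type*} [AddCommGroup A] [Module (ZMod p) A] (D : F → F ⧸ N → A)
    (hD : ∀ g h x, D (g * h) x = D h x + D g (QuotientGroup.mk' N h * x))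
    (hDR : ∀ r ∈ R, ∀ x, D r x = 0) :
    ∀ g, QuotientGroup.mk' N g = 1 → ∀ x, D g x = 0 := by
  have hone := crossed_one (QuotientGroup.mk' N) D hD
  have hmk : ∀ g, QuotientGroup.mk' N g = 1 ↔ g ∈ N := fun g => QuotientGroup.eq_one_iff g
  have hinv : ∀ g x, D g (QuotientGroup.mk' N g⁻¹ * x) = - D g⁻¹ x := by
    intro g x
    have h1 := hD g g⁻¹ x
    rw [mul_inv_cancel, hone] at h1
    exact (neg_eq_of_add_eq_zero_right h1.symm).symm
  let M : Subgroup F :=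
    { carrier := {g | g ∈ N ∧ ∀ x, D g x = 0}
      one_mem' := ⟨N.one_mem, hone⟩
      mul_mem' := by
        rintro a b ⟨ha, ha'⟩ ⟨hb, hb'⟩
        exact ⟨N.mul_mem ha hb, fun x => by rw [hD, ha', hb', add_zero]⟩
      inv_mem' := by
        rintro a ⟨ha, ha'⟩
        refine ⟨N.inv_mem ha, fun x => ?_⟩
        have := hinv a x
        rw [ha'] at this
        exact neg_eq_zero.1 this.symm }
  have hMN : M ≤ N := fun g hg => hg.1
  have hMnormal : M.Normal := by
    refine ⟨?_⟩
    rintro n ⟨hn, hn'⟩ g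
    refine ⟨hN.conj_mem n hn g, fun x => ?_⟩
    rw [hD, hD, hn', zero_add, (hmk n).2 hn, one_mul]
    rw [hinv, add_neg_cancel]
  have hRM : R ⊆ M := fun r hr => ⟨hR hr, hDR r hr⟩
  have hNC : Subgroup.normalClosure R ≤ M := Subgroup.normalClosure_le_normal hRM
  have : (Subgroup.normalClosure R).FiniteIndex := Subgroup.finiteIndex_of_finite_quotient
  have hMfi : M.FiniteIndex := Subgroup.finiteIndex_of_le hNC
  obtain ⟨k, hk⟩ := hk
  have hPG : IsPGroup p (F ⧸ M) := by
    intro q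
    induction q using QuotientGroup.induction_on with
    | H g =>
      refine ⟨k + 1, ?_⟩
      rw [← QuotientGroup.mk_pow, QuotientGroup.eq_one_iff, pow_succ, pow_mul]
      have hg : g ^ p ^ k ∈ N := by
        rw [← hk]; exact N.pow_index_mem g
      refine ⟨N.pow_mem hg p, fun x => ?_⟩
      rw [crossed_pow (QuotientGroup.mk' N) D hD _ ((hmk _).2 hg),
        ← Nat.cast_smul_eq_nsmul (ZMod p)]
      simp
  have hMk : ∃ k, M.index = p ^ k := by
    have := IsPGroup.iff_card.1 hPG
    exact this
  have hle := hmax M hMnormal hRM hMk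
  have hNM : N ≤ M := by
    have h1 := Subgroup.relIndex_mul_index hMN
    have hpos : 0 < N.index := by rw [hk]; exact pow_pos hp.out.pos k
    have hMpos : M.index ≠ 0 := Subgroup.FiniteIndex.index_ne_zero
    rw [← Subgroup.relIndex_eq_one]
    have h2 : M.relIndex N ≠ 0 := by
      intro h; rw [h, zero_mul] at h1; exact hMpos h1.symm
    have h3 : M.relIndex N * N.index ≤ 1 * N.index := by rw [h1, one_mul]; exact hle
    have h4 := Nat.le_of_mul_le_mul_right h3 hpos
    omega
  intro g hg
  exact (hNM ((hmk g).1 hg)).2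

/-- If a finitely generated group admits a presentation `⟨X | R⟩` with
`p`-deficiency at least `1` for some prime `p`, then it is infinite. -/
theorem infinite_of_pDef_ge_one {X : Type} [Fintype X] (p : ℕ) (hp : p.Prime)
    (R : Set (FreeGroup X))
    (hsum : Summable fun r : R => ((p : ℝ) ^ (nuP p (r : FreeGroup X)))⁻¹)
    (hdef : (1 : ℝ) ≤ pDef p R) :
    Infinite (PresentedGroup R) := by
  classical
  haveI : Fact p.Prime := ⟨hp⟩
  rw [← not_finite_iff_infinite]
  intro hfin
  have hfin' : Finite (FreeGroup X ⧸ Subgroup.normalClosure R) := hfin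
  obtain ⟨N, hN, hR, ⟨k, hk⟩, hmax⟩ := exists_max_normal p R hfin'
  have hcard : Nat.card (FreeGroup X ⧸ N) = p ^ k := hk
  have hPfin : Finite (FreeGroup X ⧸ N) :=
    Nat.finite_of_card_ne_zero (by rw [hcard]; exact (pow_pos hp.pos k).ne')
  have := Fintype.ofFinite (FreeGroup X ⧸ N)
  obtain ⟨D, hDof, hD⟩ := exists_crossed (A := X × (FreeGroup X ⧸ N) → ZMod p)
    (QuotientGroup.mk' N) (fun s x => Pi.single (s, x) 1)
  have hmk : ∀ g, QuotientGroup.mk' N g = 1 ↔ g ∈ N := fun g => QuotientGroup.eq_one_iff g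
  let V : R → Submodule (ZMod p) (X × (FreeGroup X ⧸ N) → ZMod p) :=
    fun r => Submodule.span (ZMod p) (Set.range (D r))
  have hV : ∀ r : R, (Module.finrank (ZMod p) (V r) : ℝ) ≤
      Nat.card (FreeGroup X ⧸ N) * ((p : ℝ) ^ nuP p (r : FreeGroup X))⁻¹ := by
    intro r
    obtain ⟨w, hw⟩ := exists_pow_nuP p (r : FreeGroup X)
    have h1 := crossed_finrank (QuotientGroup.mk' N) D hD p w (nuP p (r : FreeGroup X)) k
      (by rw [hw, hmk]; exact hR r.2) hcard
    rw [hw] at h1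
    exact h1
  have hU := finrank_iSup_le_tsum V _ (hsum.mul_left (Nat.card (FreeGroup X ⧸ N) : ℝ))
    (fun r => by positivity) hV
  rw [tsum_mul_left] at hU
  set U := ⨆ r, V r with hUdef
  let E : FreeGroup X → FreeGroup X ⧸ N → (X × (FreeGroup X ⧸ N) → ZMod p) ⧸ U :=
    fun g x => U.mkQ (D g x)
  have hE : ∀ g h x, E (g * h) x = E h x + E g (QuotientGroup.mk' N h * x) := by
    intro g h x
    simp only [E]
    rw [hD, map_add]
  have hER : ∀ r ∈ R, ∀ x, E r x = 0 := by
    intro r hr x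
    have h1 : D r x ∈ V ⟨r, hr⟩ := Submodule.subset_span ⟨x, rfl⟩
    have h2 : D r x ∈ U := le_iSup V ⟨r, hr⟩ h1
    simpa [E] using h2
  have hkill := crossed_kill p R hfin' N hR ⟨k, hk⟩ hmax E hE hER
  have hsmall := crossed_small (QuotientGroup.mk' N) E hE (ZMod p)
    (QuotientGroup.mk'_surjective N) hkill
  have htop : Submodule.span (ZMod p) {a | ∃ g x, a = E g x} = ⊤ := by
    rw [eq_top_iff]
    rintro a -
    obtain ⟨b, rfl⟩ := U.mkQ_surjective a
    rw [pi_eq_sum_univ' b, map_sum]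
    refine Submodule.sum_mem _ fun i _ => ?_
    rw [map_smul]
    refine Submodule.smul_mem _ _ (Submodule.subset_span ⟨FreeGroup.of i.1, i.2, ?_⟩)
    simp only [E]
    rw [hDof]
  rw [htop, finrank_top] at hsmall
  have hq := U.finrank_quotient_add_finrank
  rw [Module.finrank_pi, Fintype.card_prod, ← Nat.card_eq_fintype_card (α := FreeGroup X ⧸ N)] at hq
  unfold pDef at hdef
  have hq' : (Module.finrank (ZMod p) ((X × (FreeGroup X ⧸ N) → ZMod p) ⧸ U) : ℝ)
      + Module.finrank (ZMod p) U = Fintype.card X * Nat.card (FreeGroup X ⧸ N) := by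
    exact_mod_cast hq
  have hsmall' : (Module.finrank (ZMod p) ((X × (FreeGroup X ⧸ N) → ZMod p) ⧸ U) : ℝ)
      < Nat.card (FreeGroup X ⧸ N) := by exact_mod_cast hsmall
  have hn : (0 : ℝ) ≤ Nat.card (FreeGroup X ⧸ N) := by positivity
  nlinarith [mul_le_mul_of_nonneg_left hdef hn]
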